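/- Let K be a compact Hausdorff space, (L,μ) a compact measure space, and T : C(K;ℂ) → L¹(L,μ) a linear operator. Then the following are equivalent: (i) T is order-bounded; (ii) T is regular; (iii) there is a finite positive regular Borel measure ν on K such that ‖Tf‖_{L¹(L,μ)} ≤ ∫_K |f| dν for all f ∈ C(K); (iv) there is a continuous linear functional Λ on C(K×L;ℂ) such that Λ(f⊗g) = ∫_L (Tf)·g dμ for all f ∈ C(K) and g ∈ C(L), where (f⊗g)(x,y) := f(x)g(y). In this case, Λ in (iv) is unique, and for every ν as in (iii) one has ∫_X |T|f dμ ≤ ∫_K f dν for all 0 ≤ f ∈ C(K). -/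

import Mathlib

open MeasureTheory ComplexConjugate
open scoped ENNReal ComplexOrder

noncomputable section

variable {K : Type*} [TopologicalSpace K] [CompactSpace K] [T2Space K]
  [MeasurableSpace K] [BorelSpace K]
variable {L : Type*} [TopologicalSpace L] [CompactSpace L] [T2Space L]
  [MeasurableSpace L] [BorelSpace L]

/-- `T : C(K;ℂ) → L¹(L,μ)` is order-bounded. -/
def OrderBounded {μ : Measure L} (T : C(K, ℂ) → Lp ℂ 1 μ) : Prop :=
  ∀ f : C(K, ℂ), (∀ t, 0 ≤ f t) → ∃ h : Lp ℂ 1 μ, (∀ᵐ x ∂μ, 0 ≤ h x) ∧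
    ∀ g : C(K, ℂ), (∀ t, (‖g t‖ : ℂ) ≤ f t) → ∀ᵐ x ∂μ, (‖T g x‖ : ℂ) ≤ h x

/-- `T` is a positive operator. -/
def PositiveOp {μ : Measure L} (T : C(K, ℂ) → Lp ℂ 1 μ) : Prop :=
  ∀ f : C(K, ℂ), (∀ t, 0 ≤ f t) → ∀ᵐ x ∂μ, 0 ≤ T f x

/-- `T` is regular: a linear combination of positive linear operators. -/
def RegularOp {μ : Measure L} (T : C(K, ℂ) →ₗ[ℂ] Lp ℂ 1 μ) : Prop :=
  ∃ (n : ℕ) (c : Fin n → ℂ) (P : Fin n → (C(K, ℂ) →ₗ[ℂ] Lp ℂ 1 μ)),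
    (∀ i, PositiveOp ⇑(P i)) ∧ T = ∑ i, c i • P i

/-- `absT` is a linear modulus for `T`. -/
def IsLinearModulus {μ : Measure L} (T absT : C(K, ℂ) → Lp ℂ 1 μ) : Prop :=
  ∀ f : C(K, ℂ), (∀ t, 0 ≤ f t) →
    (∀ g : C(K, ℂ), (∀ t, (‖g t‖ : ℂ) ≤ f t) →
        ∀ᵐ x ∂μ, (‖T g x‖ : ℂ) ≤ absT f x) ∧
    (∀ h : Lp ℂ 1 μ,
        (∀ g : C(K, ℂ), (∀ t, (‖g t‖ : ℂ) ≤ f t) → ∀ᵐ x ∂μ, (‖T g x‖ : ℂ) ≤ h x) →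
        ∀ᵐ x ∂μ, absT f x ≤ h x)

/-- The elementary tensor `f ⊗ g ∈ C(K×L;ℂ)`. -/
def tensorCM (f : C(K, ℂ)) (g : C(L, ℂ)) : C(K × L, ℂ) :=
  ⟨fun p => f p.1 * g p.2,
    ((f.continuous.comp continuous_fst).mul (g.continuous.comp continuous_snd))⟩

section LatticeL1

variable {α : Type*} [MeasurableSpace α] {μ : Measure α}

theorem L1_norm_eq_integral_of_nonneg {u : Lp ℝ 1 μ} (hu : 0 ≤ u) : ‖u‖ = ∫ x, u x ∂μ := by
  rw [L1.norm_eq_integral_norm]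
  refine integral_congr_ae ?_
  filter_upwards [(Lp.coeFn_nonneg u).2 hu] with x hx
  exact Real.norm_of_nonneg hx

theorem L1_integral_sub (u v : Lp ℝ 1 μ) :
    ∫ x, (u - v : Lp ℝ 1 μ) x ∂μ = ∫ x, u x ∂μ - ∫ x, v x ∂μ := by
  rw [integral_congr_ae (Lp.coeFn_sub u v)]
  exact integral_sub (L1.integrable_coeFn u) (L1.integrable_coeFn v)

theorem L1_integral_mono {u v : Lp ℝ 1 μ} (huv : u ≤ v) : ∫ x, u x ∂μ ≤ ∫ x, v x ∂μ :=
  integral_mono_ae (L1.integrable_coeFn u) (L1.integrable_coeFn v) ((Lp.coeFn_le u v).2 huv)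

/-- A nonempty sup-closed subset of `L¹` with bounded integrals has a least upper bound. -/
theorem L1_exists_isLUB_of_supClosed {s : Set (Lp ℝ 1 μ)} (hne : s.Nonempty) (hs : SupClosed s)
    {M : ℝ} (hM : ∀ u ∈ s, ∫ x, u x ∂μ ≤ M) :
    ∃ w : Lp ℝ 1 μ, IsLUB s w ∧ ∫ x, w x ∂μ ≤ M := by
  set I : Lp ℝ 1 μ → ℝ := fun u => ∫ x, u x ∂μ with hI
  have hIc : Continuous I := continuous_integral
  have hbdd : BddAbove (I '' s) := ⟨M, by rintro _ ⟨u, hu, rfl⟩; exact hM u hu⟩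
  set a := sSup (I '' s) with ha
  have hle : ∀ u ∈ s, I u ≤ a := fun u hu => le_csSup hbdd ⟨u, hu, rfl⟩
  obtain ⟨y, -, hy, hys⟩ := exists_seq_tendsto_sSup (hne.image I) hbdd
  choose v hvs hv using hys
  set u : ℕ →o Lp ℝ 1 μ := partialSups v with hu
  have hus : ∀ n, u n ∈ s := by
    intro n
    induction n with
    | zero => simpa [hu] using hvs 0
    | succ n ih => simpa [hu, partialSups_add_one] using hs ih (hvs (n + 1))
  have hIu : Filter.Tendsto (fun n => I (u n)) Filter.atTop (nhds a) := by
    refine tendsto_of_tendsto_of_tendsto_of_le_of_le hy tendsto_const_nhds ?_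
      (fun n => hle _ (hus n))
    intro n
    simpa [← hv n] using L1_integral_mono (le_partialSups v n)
  have hdist : ∀ m n, m ≤ n → dist (u m) (u n) = I (u n) - I (u m) := by
    intro m n hmn
    rw [dist_comm, dist_eq_norm, L1_norm_eq_integral_of_nonneg (sub_nonneg.2 (u.monotone hmn)),
      L1_integral_sub]
  have hcau : CauchySeq u := by
    refine Metric.cauchySeq_iff'.2 fun ε hε => ?_
    obtain ⟨N, hN⟩ := (hIu.eventually (lt_mem_nhds (sub_lt_self a hε))).exists
    refine ⟨N, fun n hn => ?_⟩
    rw [dist_comm, hdist N n hn]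
    linarith [hle _ (hus n)]
  obtain ⟨w, hw⟩ := cauchySeq_tendsto_of_complete hcau
  have hIw : I w = a := tendsto_nhds_unique ((hIc.tendsto w).comp hw) hIu
  have huw : ∀ n, u n ≤ w := u.monotone.ge_of_tendsto hw
  refine ⟨w, ⟨fun x hx => ?_, fun b hb => le_of_tendsto' hw fun n => hb (hus n)⟩, ?_⟩
  · have h1 : Filter.Tendsto (fun n => u n ⊔ x) Filter.atTop (nhds (w ⊔ x)) :=
      hw.sup_nhds tendsto_const_nhds
    have h2 : I (w ⊔ x) ≤ a :=
      le_of_tendsto' ((hIc.tendsto _).comp h1) fun n => hle _ (hs (hus n) hx)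
    have h3 : ‖w ⊔ x - w‖ ≤ 0 := by
      rw [L1_norm_eq_integral_of_nonneg (sub_nonneg.2 le_sup_left), L1_integral_sub]
      linarith
    have h4 : w ⊔ x = w := sub_eq_zero.1 (norm_le_zero_iff.1 h3)
    exact h4 ▸ le_sup_right
  · change I w ≤ M
    rw [hIw]
    exact csSup_le (hne.image I) (by rintro _ ⟨u, hu, rfl⟩; exact hM u hu)

/-- A nonempty subset of `L¹` whose finite subsets have upper bounds with uniformly bounded
integrals has a least upper bound. -/
theorem L1_exists_isLUB {s : Set (Lp ℝ 1 μ)} (hne : s.Nonempty) {M : ℝ}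
    (hM : ∀ t : Finset (Lp ℝ 1 μ), ↑t ⊆ s →
      ∃ b : Lp ℝ 1 μ, (∀ u ∈ t, u ≤ b) ∧ ∫ x, b x ∂μ ≤ M) :
    ∃ w : Lp ℝ 1 μ, IsLUB s w ∧ ∫ x, w x ∂μ ≤ M := by
  obtain ⟨w, hw, hwM⟩ := L1_exists_isLUB_of_supClosed (M := M) (hne.mono subset_supClosure)
    supClosed_supClosure
    (by
      rintro _ ⟨t, ht, hts, rfl⟩
      obtain ⟨b, hb, hbM⟩ := hM t hts
      exact (L1_integral_mono (Finset.sup'_le _ _ hb)).trans hbM)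
  exact ⟨w, isLUB_supClosure.1 hw, hwM⟩

instance L1_posSMulMono : PosSMulMono ℝ (Lp ℝ 1 μ) where
  smul_le_smul_of_nonneg_left c hc u v huv := by
    rw [← Lp.coeFn_le] at huv ⊢
    filter_upwards [huv, Lp.coeFn_smul c u, Lp.coeFn_smul c v] with x hx hu hv
    rw [hu, hv]
    exact smul_le_smul_of_nonneg_left hx hc

end LatticeL1

section PositiveExtension

variable {X : Type*} [TopologicalSpace X]
variable {E : Type*} [AddCommGroup E] [Module ℝ E]

/-- An additive, positively homogeneous map on the nonnegative real continuous functions extends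
to a linear map. -/
theorem exists_linearMap_of_additive_of_nonneg (p : C(X, ℝ) → E)
    (hadd : ∀ f g, 0 ≤ f → 0 ≤ g → p (f + g) = p f + p g)
    (hsmul : ∀ (c : ℝ) f, 0 < c → 0 ≤ f → p (c • f) = c • p f) :
    ∃ P : C(X, ℝ) →ₗ[ℝ] E, ∀ f, 0 ≤ f → P f = p f := by
  have h0 : p 0 = 0 := by simpa using hadd 0 0 le_rfl le_rfl
  have hsub : ∀ f g h k : C(X, ℝ), 0 ≤ f → 0 ≤ g → 0 ≤ h → 0 ≤ k → f - g = h - k →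
      p f - p g = p h - p k := by
    intro f g h k hf hg hh hk e
    rw [sub_eq_sub_iff_add_eq_add] at e ⊢
    rw [← hadd f k hf hk, ← hadd h g hh hg, e]
  have hpos : ∀ f : C(X, ℝ), 0 ≤ f ⊔ 0 := fun f => le_sup_right
  have hdec : ∀ f : C(X, ℝ), f ⊔ 0 - (-f) ⊔ 0 = f := fun f => posPart_sub_negPart f
  refine ⟨
    { toFun := fun f => p (f ⊔ 0) - p ((-f) ⊔ 0)
      map_add' := fun f g => ?_
      map_smul' := fun c f => ?_ }, fun f hf => ?_⟩
  · rw [sub_add_sub_comm, ← hadd _ _ (hpos _) (hpos _), ← hadd _ _ (hpos _) (hpos _)]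
    refine hsub _ _ _ _ (hpos _) (hpos _) (add_nonneg (hpos _) (hpos _))
      (add_nonneg (hpos _) (hpos _)) ?_
    rw [← sub_add_sub_comm, hdec, hdec, hdec]
  · rcases lt_trichotomy c 0 with hc | rfl | hc
    · have hc' : 0 < -c := neg_pos.2 hc
      have : c • (p (f ⊔ 0) - p ((-f) ⊔ 0)) = p ((-c) • ((-f) ⊔ 0)) - p ((-c) • (f ⊔ 0)) := by
        rw [hsmul _ _ hc' (hpos _), hsmul _ _ hc' (hpos _)]
        module
      simp only [RingHom.id_apply]
      rw [this]
      refine hsub _ _ _ _ (hpos _) (hpos _) (smul_nonneg hc'.le (hpos _))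
        (smul_nonneg hc'.le (hpos _)) ?_
      rw [← smul_sub, hdec, ← neg_sub, hdec]
      simp
    · simp
    · simp only [RingHom.id_apply]
      rw [smul_sub, ← hsmul _ _ hc (hpos _), ← hsmul _ _ hc (hpos _)]
      refine hsub _ _ _ _ (hpos _) (hpos _) (smul_nonneg hc.le (hpos _))
        (smul_nonneg hc.le (hpos _)) ?_
      rw [← smul_sub, hdec, hdec]
  · have h1 : f ⊔ 0 = f := sup_eq_left.2 hf
    have h2 : (-f) ⊔ 0 = 0 := sup_eq_right.2 (neg_nonpos.2 hf)
    simp [h1, h2, h0]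

/-- Riesz–Kantorovich. -/
theorem exists_positive_linearMap_ge [PartialOrder E] [IsOrderedAddMonoid E] [PosSMulMono ℝ E]
    (S : C(X, ℝ) →ₗ[ℝ] E)
    (hS : ∀ f, 0 ≤ f → ∃ w, IsLUB (S '' Set.Icc 0 f) w) :
    ∃ P : C(X, ℝ) →ₗ[ℝ] E, ∀ f, 0 ≤ f → 0 ≤ P f ∧ S f ≤ P f := by
  have hS' : ∀ f, ∃ w, 0 ≤ f → IsLUB (S '' Set.Icc 0 f) w := fun f => by
    by_cases hf : 0 ≤ f
    · exact (hS f hf).imp fun w hw _ => hw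
    · exact ⟨0, fun h => absurd h hf⟩
  choose p hp using hS'
  have hup : ∀ f g, 0 ≤ g → g ≤ f → S g ≤ p f := fun f g hg hgf =>
    (hp f (hg.trans hgf)).1 ⟨g, ⟨hg, hgf⟩, rfl⟩
  have hlub : ∀ f b, 0 ≤ f → (∀ g, 0 ≤ g → g ≤ f → S g ≤ b) → p f ≤ b := fun f b hf hb =>
    (hp f hf).2 (by rintro _ ⟨g, hg, rfl⟩; exact hb g hg.1 hg.2)
  have hscale : ∀ (c : ℝ) f, 0 < c → 0 ≤ f → c • p f ≤ p (c • f) := by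
    intro c f hc hf
    have : p f ≤ c⁻¹ • p (c • f) := by
      refine hlub f _ hf fun g hg hgf => ?_
      have h := smul_le_smul_of_nonneg_left
        (hup (c • f) (c • g) (smul_nonneg hc.le hg) (smul_le_smul_of_nonneg_left hgf hc.le))
        (inv_pos.2 hc).le
      rwa [map_smul, inv_smul_smul₀ hc.ne'] at h
    have h := smul_le_smul_of_nonneg_left this hc.le
    rwa [smul_inv_smul₀ hc.ne'] at h
  obtain ⟨P, hP⟩ := exists_linearMap_of_additive_of_nonneg p
    (by
      intro f g hf hg
      refine le_antisymm (hlub _ _ (add_nonneg hf hg) fun k hk hkfg => ?_) ?_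
      · have h1 : S k = S (k ⊓ f) + S (k - k ⊓ f) := by rw [← map_add, add_sub_cancel]
        rw [h1]
        refine add_le_add (hup f _ (le_inf hk hf) inf_le_right)
          (hup g _ (sub_nonneg.2 inf_le_left) ?_)
        rw [sub_le_iff_le_add, ← sub_le_iff_le_add']
        exact le_inf (sub_le_self _ hg) (sub_le_iff_le_add.2 hkfg)
      · rw [← le_sub_iff_add_le]
        refine hlub _ _ hf fun k hk hkf => ?_
        rw [le_sub_comm]
        refine hlub _ _ hg fun l hl hlg => ?_
        rw [le_sub_iff_add_le, ← map_add, add_comm l k]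
        exact hup _ _ (add_nonneg hk hl) (add_le_add hkf hlg))
    (by
      intro c f hc hf
      refine le_antisymm ?_ (hscale c f hc hf)
      have h := smul_le_smul_of_nonneg_left
        (hscale c⁻¹ (c • f) (inv_pos.2 hc) (smul_nonneg hc.le hf)) hc.le
      rwa [inv_smul_smul₀ hc.ne', smul_inv_smul₀ hc.ne'] at h)
  refine ⟨P, fun f hf => ?_⟩
  rw [hP f hf]
  exact ⟨by simpa using hup f 0 le_rfl hf, hup f f hf le_rfl⟩

end PositiveExtension

section NormL1

variable {α : Type*} [MeasurableSpace α] {μ : Measure α}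

/-- The pointwise norm `|u| ∈ L¹(μ;ℝ)` of `u ∈ L¹(μ;ℂ)`. -/
def L1abs (u : Lp ℂ 1 μ) : Lp ℝ 1 μ := lipschitzWith_one_norm.compLp norm_zero u

theorem L1abs_coeFn (u : Lp ℂ 1 μ) : ∀ᵐ x ∂μ, L1abs u x = ‖u x‖ :=
  lipschitzWith_one_norm.coeFn_compLp norm_zero u

theorem integral_L1abs (u : Lp ℂ 1 μ) : ∫ x, L1abs u x ∂μ = ‖u‖ := by
  rw [L1.norm_eq_integral_norm, integral_congr_ae (L1abs_coeFn u)]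

theorem L1abs_add_le (u v : Lp ℂ 1 μ) : L1abs (u + v) ≤ L1abs u + L1abs v := by
  rw [← Lp.coeFn_le]
  filter_upwards [L1abs_coeFn u, L1abs_coeFn v, L1abs_coeFn (u + v), Lp.coeFn_add u v,
    Lp.coeFn_add (L1abs u) (L1abs v)] with x h1 h2 h3 h4 h5
  rw [h5, Pi.add_apply, h1, h2, h3, h4]
  exact norm_add_le _ _

theorem L1abs_smul (c : ℂ) (u : Lp ℂ 1 μ) : L1abs (c • u) = ‖c‖ • L1abs u := by
  refine Lp.ext ?_
  filter_upwards [L1abs_coeFn u, L1abs_coeFn (c • u), Lp.coeFn_smul c u,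
    Lp.coeFn_smul ‖c‖ (L1abs u)] with x h1 h2 h3 h4
  rw [h2, h3, h4, Pi.smul_apply, Pi.smul_apply, h1, norm_smul, smul_eq_mul]

theorem L1abs_nonneg (u : Lp ℂ 1 μ) : 0 ≤ L1abs u := by
  rw [← Lp.coeFn_nonneg]
  filter_upwards [L1abs_coeFn u] with x hx
  rw [hx]
  exact norm_nonneg _

theorem L1abs_sum_le {ι : Type*} (s : Finset ι) (u : ι → Lp ℂ 1 μ) :
    L1abs (∑ i ∈ s, u i) ≤ ∑ i ∈ s, L1abs (u i) := by
  refine Finset.le_sum_of_subadditive _ ?_ L1abs_add_le s u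
  exact le_of_eq (by simpa using L1abs_smul (0 : ℂ) (0 : Lp ℂ 1 μ))

theorem L1_integral_add (u v : Lp ℝ 1 μ) :
    ∫ x, (u + v : Lp ℝ 1 μ) x ∂μ = ∫ x, u x ∂μ + ∫ x, v x ∂μ := by
  rw [integral_congr_ae (Lp.coeFn_add u v)]
  exact integral_add (L1.integrable_coeFn u) (L1.integrable_coeFn v)

theorem L1_integral_sum {ι : Type*} (s : Finset ι) (u : ι → Lp ℝ 1 μ) :
    ∫ x, (∑ i ∈ s, u i : Lp ℝ 1 μ) x ∂μ = ∑ i ∈ s, ∫ x, u i x ∂μ := by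
  classical
  induction s using Finset.induction_on with
  | empty =>
    simp only [Finset.sum_empty]
    rw [integral_congr_ae (Lp.coeFn_zero ℝ 1 μ)]
    simp
  | insert i s hi ih => rw [Finset.sum_insert hi, Finset.sum_insert hi, L1_integral_add, ih]

theorem L1_integral_smul (c : ℝ) (u : Lp ℝ 1 μ) :
    ∫ x, (c • u : Lp ℝ 1 μ) x ∂μ = c * ∫ x, u x ∂μ := by
  rw [integral_congr_ae (Lp.coeFn_smul c u)]
  exact integral_const_mul c _

end NormL1

section PartitionOfUnity

variable {X : Type*} [TopologicalSpace X] [CompactSpace X]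

/-- Finitely many continuous functions are simultaneously uniformly approximated by their
interpolations along a suitable finite partition of unity. -/
theorem exists_partition_approx [T2Space X] {ι : Type*} [Finite ι] (h : ι → C(X, ℂ))
    {ε : ℝ} (hε : 0 < ε) :
    ∃ (n : ℕ) (χ : Fin n → C(X, ℂ)) (t : Fin n → X), (∀ j x, 0 ≤ χ j x) ∧ ∑ j, χ j = 1 ∧
      ∀ i, ‖h i - ∑ j, h i (t j) • χ j‖ ≤ ε := by
  set U : X → Set X := fun x => {s | ∀ i, ‖h i s - h i x‖ < ε} with hU
  have hUo : ∀ x, IsOpen (U x) := fun x => by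
    simp only [hU, Set.ofPred_forall]
    exact isOpen_iInter_of_finite fun i =>
      isOpen_lt ((h i).continuous.sub continuous_const).norm continuous_const
  obtain ⟨F, hF⟩ := isCompact_univ.elim_finite_subcover U hUo
    (fun x _ => Set.mem_iUnion.2 ⟨x, fun i => by simpa using hε⟩)
  let e := F.equivFin
  obtain ⟨φ, hφs, hφ1, hφI, -⟩ := exists_continuous_sum_one_of_isOpen_isCompact
    (s := fun j => U (e.symm j)) (fun j => hUo _) isCompact_univ (by
      intro x hx
      obtain ⟨y, hy, hxy⟩ := Set.mem_iUnion₂.1 (hF hx)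
      exact Set.mem_iUnion.2 ⟨e ⟨y, hy⟩, by simpa using hxy⟩)
  have hsum : ∀ x, ∑ j, (φ j x : ℂ) = 1 := fun x => by
    have := hφ1 (Set.mem_univ x)
    simp only [Finset.sum_apply, Pi.one_apply] at this
    exact_mod_cast this
  refine ⟨_, fun j => ⟨fun x => (φ j x : ℂ), by fun_prop⟩, fun j => e.symm j,
    fun j x => by simpa using (hφI j x).1, ?_, fun i => ?_⟩
  · ext x
    simpa [ContinuousMap.sum_apply] using hsum x
  · refine (ContinuousMap.norm_le _ hε.le).2 fun x => ?_
    have h1 : (h i - ∑ j, h i (e.symm j) • (⟨fun x => (φ j x : ℂ), by fun_prop⟩ : C(X, ℂ))) x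
        = ∑ j, (h i x - h i (e.symm j)) * (φ j x : ℂ) := by
      simp only [ContinuousMap.sub_apply, ContinuousMap.sum_apply, ContinuousMap.smul_apply,
        ContinuousMap.coe_mk, smul_eq_mul, sub_mul, Finset.sum_sub_distrib]
      rw [← Finset.mul_sum, hsum, mul_one]
    rw [h1]
    calc ‖∑ j, (h i x - h i (e.symm j)) * (φ j x : ℂ)‖
        ≤ ∑ j, ε * φ j x := by
          refine norm_sum_le_of_le _ fun j _ => ?_
          rw [norm_mul, Complex.norm_of_nonneg (hφI j x).1]
          by_cases hx : φ j x = 0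
          · simp [hx]
          · exact mul_le_mul_of_nonneg_right
              (hφs j (subset_tsupport _ hx) i).le (hφI j x).1
      _ = ε := by
          rw [← Finset.mul_sum]
          have : ∑ j, φ j x = 1 := by exact_mod_cast hsum x
          rw [this, mul_one]

/-- `T` is bounded by `C`, and sums of norms of `T` along finite partitions of unity are
bounded by `C`. -/
def PartitionBound {F : Type*} [NormedAddCommGroup F] [NormedSpace ℂ F]
    (T : C(X, ℂ) →ₗ[ℂ] F) (C : ℝ) : Prop :=
  (∀ f, ‖T f‖ ≤ C * ‖f‖) ∧
    ∀ (n : ℕ) (χ : Fin n → C(X, ℂ)), (∀ j x, 0 ≤ χ j x) → ∑ j, χ j = 1 → ∑ j, ‖T (χ j)‖ ≤ C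

theorem PartitionBound.nonneg {F : Type*} [NormedAddCommGroup F] [NormedSpace ℂ F]
    {T : C(X, ℂ) →ₗ[ℂ] F} {C : ℝ} (h : PartitionBound T C) : 0 ≤ C :=
  (norm_nonneg _).trans (by simpa using h.2 1 (fun _ => 1) (by simp) (by simp))

variable {α : Type*} [MeasurableSpace α] {μ : Measure α}

theorem exists_upper_bound_of_finite [T2Space X] {T : C(X, ℂ) →ₗ[ℂ] Lp ℂ 1 μ} {C : ℝ} (hC : 0 ≤ C)
    (hT : ∀ f, ‖T f‖ ≤ C * ‖f‖) {ι : Type*} [Fintype ι] (f : C(X, ℂ)) (g : ι → C(X, ℂ))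
    (hg : ∀ i x, ‖g i x‖ ≤ ‖f x‖) {δ : ℝ} (hδ : 0 < δ) :
    ∃ (n : ℕ) (χ : Fin n → C(X, ℂ)) (t : Fin n → X) (b : Lp ℝ 1 μ),
      (∀ j x, 0 ≤ χ j x) ∧ ∑ j, χ j = 1 ∧ ‖f - ∑ j, f (t j) • χ j‖ ≤ δ ∧
      (∀ i, L1abs (T (g i)) ≤ b) ∧ ∫ x, b x ∂μ ≤ ∑ j, ‖f (t j)‖ * ‖T (χ j)‖ + δ := by
  set N : ℝ := Fintype.card ι * C + 1 with hN
  have hN1 : 1 ≤ N := by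
    have : (0 : ℝ) ≤ Fintype.card ι * C := by positivity
    linarith
  have hN0 : 0 < N := by linarith
  obtain ⟨n, χ, t, hχ0, hχ1, hχ⟩ := exists_partition_approx
    (fun o : Option ι => o.elim f g) (div_pos hδ hN0)
  have hf := hχ none
  have hgi := fun i => hχ (some i)
  simp only [Option.elim_none, Option.elim_some] at hf hgi
  set r : ι → C(X, ℂ) := fun i => g i - ∑ j, g i (t j) • χ j with hr
  refine ⟨n, χ, t, ∑ j, ‖f (t j)‖ • L1abs (T (χ j)) + ∑ i, L1abs (T (r i)), hχ0, hχ1,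
    hf.trans (div_le_self hδ.le hN1), fun i => ?_, ?_⟩
  · have h1 : T (g i) = ∑ j, g i (t j) • T (χ j) + T (r i) := by
      simp only [← map_smul, ← map_sum, ← map_add, hr, add_sub_cancel]
    rw [h1]
    refine (L1abs_add_le _ _).trans (add_le_add ((L1abs_sum_le _ _).trans ?_) ?_)
    · refine Finset.sum_le_sum fun j _ => ?_
      rw [L1abs_smul, ← sub_nonneg, ← sub_smul]
      exact smul_nonneg (sub_nonneg.2 (hg i _)) (L1abs_nonneg _)
    · exact Finset.single_le_sum (f := fun i => L1abs (T (r i)))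
        (fun i _ => L1abs_nonneg _) (Finset.mem_univ i)
  · rw [L1_integral_add, L1_integral_sum, L1_integral_sum]
    simp only [L1_integral_smul, integral_L1abs]
    refine add_le_add_right ?_ _
    calc ∑ i, ‖T (r i)‖ ≤ ∑ _i : ι, C * (δ / N) :=
          Finset.sum_le_sum fun i _ => (hT _).trans (mul_le_mul_of_nonneg_left (hgi i) hC)
      _ = (Fintype.card ι * C) * (δ / N) := by simp [mul_assoc]
      _ ≤ N * (δ / N) := by
          refine mul_le_mul_of_nonneg_right ?_ (div_pos hδ hN0).le
          linarith
      _ = δ := by field_simp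

/-- The supremum of `{|Tg| : |g| ≤ |f|}` exists in `L¹` as soon as the interpolation sums of
`f` are uniformly bounded. -/
theorem exists_isLUB_L1abs [T2Space X] {T : C(X, ℂ) →ₗ[ℂ] Lp ℂ 1 μ} {C : ℝ} (hC : 0 ≤ C)
    (hT : ∀ f, ‖T f‖ ≤ C * ‖f‖) (f : C(X, ℂ)) {M δ : ℝ} (hδ : 0 < δ)
    (hM : ∀ (n : ℕ) (χ : Fin n → C(X, ℂ)) (t : Fin n → X), (∀ j x, 0 ≤ χ j x) → ∑ j, χ j = 1 →
      ‖f - ∑ j, f (t j) • χ j‖ ≤ δ → ∑ j, ‖f (t j)‖ * ‖T (χ j)‖ ≤ M) :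
    ∃ w : Lp ℝ 1 μ, IsLUB ((fun g => L1abs (T g)) '' {g | ∀ x, ‖g x‖ ≤ ‖f x‖}) w ∧
      ∫ x, w x ∂μ ≤ M + δ := by
  refine L1_exists_isLUB (Set.Nonempty.image _ ⟨0, fun x => by simp⟩) fun t ht => ?_
  choose g hg hgt using fun u : t => ht u.2
  obtain ⟨n, χ, p, b, h0, h1, h2, h3, h4⟩ := exists_upper_bound_of_finite hC hT f g hg hδ
  refine ⟨b, fun u hu => ?_, h4.trans (by linarith [hM n χ p h0 h1 h2])⟩
  have := h3 ⟨u, hu⟩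
  rwa [show L1abs (T (g ⟨u, hu⟩)) = u from hgt ⟨u, hu⟩] at this

end PartitionOfUnity

section Pairing

variable {Y : Type*} [TopologicalSpace Y] [CompactSpace Y] [MeasurableSpace Y] [BorelSpace Y]
  {μ : Measure Y}

theorem integrable_mul_continuousMap (u : Lp ℂ 1 μ) (g : C(Y, ℂ)) :
    Integrable (fun y => u y * g y) μ :=
  (L1.integrable_coeFn u).mul_bdd g.continuous.aestronglyMeasurable
    (Filter.Eventually.of_forall fun y => g.norm_coe_le_norm y)

/-- The pairing `(u, g) ↦ ∫ u g dμ` between `L¹(Y,μ)` and `C(Y)`. -/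
def L1pairing (μ : Measure Y) : Lp ℂ 1 μ →ₗ[ℂ] C(Y, ℂ) →ₗ[ℂ] ℂ :=
  LinearMap.mk₂ ℂ (fun u g => ∫ y, u y * g y ∂μ)
    (fun u v g => by
      rw [← integral_add (integrable_mul_continuousMap u g) (integrable_mul_continuousMap v g)]
      refine integral_congr_ae ?_
      filter_upwards [Lp.coeFn_add u v] with y hy
      rw [hy, Pi.add_apply, add_mul])
    (fun c u g => by
      rw [smul_eq_mul, ← integral_const_mul]
      refine integral_congr_ae ?_
      filter_upwards [Lp.coeFn_smul c u] with y hy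
      rw [hy, Pi.smul_apply, smul_eq_mul, mul_assoc])
    (fun u g h => by
      rw [← integral_add (integrable_mul_continuousMap u g) (integrable_mul_continuousMap u h)]
      simp only [ContinuousMap.add_apply, mul_add])
    (fun c u g => by
      rw [smul_eq_mul, ← integral_const_mul]
      simp only [ContinuousMap.smul_apply, smul_eq_mul, mul_left_comm])

theorem L1pairing_apply (u : Lp ℂ 1 μ) (g : C(Y, ℂ)) :
    L1pairing μ u g = ∫ y, u y * g y ∂μ := rfl

theorem norm_L1pairing_le (u : Lp ℂ 1 μ) (g : C(Y, ℂ)) : ‖L1pairing μ u g‖ ≤ ‖u‖ * ‖g‖ := by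
  rw [L1pairing_apply, L1.norm_eq_integral_norm, ← integral_mul_const]
  refine norm_integral_le_of_norm_le ((L1.integrable_coeFn u).norm.mul_const _)
    (Filter.Eventually.of_forall fun y => ?_)
  rw [norm_mul]
  exact mul_le_mul_of_nonneg_left (g.norm_coe_le_norm y) (norm_nonneg _)

/-- Continuous functions of norm at most one are norming for `L¹`. -/
theorem exists_norming_continuousMap [T2Space Y] [IsFiniteMeasure μ] [μ.WeaklyRegular]
    (u : Lp ℂ 1 μ) {ε : ℝ} (hε : 0 < ε) :
    ∃ g : C(Y, ℂ), ‖g‖ ≤ 1 ∧ ‖u‖ - ε ≤ (L1pairing μ u g).re := by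
  set m : ℝ := μ.real Set.univ with hm
  have hm0 : 0 ≤ m := measureReal_nonneg
  obtain ⟨v, hv⟩ := (ContinuousMap.toLp_denseRange ℂ μ ℂ (p := 1) (by simp)).exists_dist_lt u
    (show 0 < ε / 3 by positivity)
  set V : Lp ℂ 1 μ := ContinuousMap.toLp 1 μ ℂ v with hV
  rw [dist_eq_norm] at hv
  set δ : ℝ := ε / (3 * (m + 1)) with hδ
  have hδ0 : 0 < δ := by positivity
  have hδm : δ * m ≤ ε / 3 := by
    rw [hδ, div_mul_eq_mul_div, div_le_div_iff₀ (by positivity) (by positivity)]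
    nlinarith
  have hmax : ∀ y, 0 < max ‖v y‖ δ := fun y => lt_max_of_lt_right hδ0
  let g : C(Y, ℂ) := ⟨fun y => conj (v y) / ((max ‖v y‖ δ : ℝ) : ℂ), by
    refine Continuous.div (Complex.continuous_conj.comp v.continuous) (by fun_prop) fun y => ?_
    exact_mod_cast (hmax y).ne'⟩
  have hg : ‖g‖ ≤ 1 := by
    refine (ContinuousMap.norm_le _ zero_le_one).2 fun y => ?_
    simp only [g, ContinuousMap.coe_mk, norm_div, RCLike.norm_conj, Complex.norm_real]
    rw [Real.norm_of_nonneg (hmax y).le]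
    exact div_le_one_of_le₀ (le_max_left _ _) (hmax y).le
  have hVv : ∀ᵐ y ∂μ, V y = v y := ContinuousMap.coeFn_toLp μ v
  have h1 : ‖V‖ - δ * m ≤ (L1pairing μ V g).re := by
    have hI := integrable_mul_continuousMap V g
    have e : (L1pairing μ V g).re = ∫ y, (V y * g y).re ∂μ := (integral_re hI).symm
    rw [e, L1.norm_eq_integral_norm, hm, mul_comm, ← smul_eq_mul (μ.real Set.univ),
      ← integral_const, ← integral_sub (L1.integrable_coeFn V).norm (integrable_const _)]
    refine integral_mono_ae ((L1.integrable_coeFn V).norm.sub (integrable_const _)) hI.re ?_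
    filter_upwards [hVv] with y hy
    have h2 : (V y * g y) = ((‖v y‖ ^ 2 / max ‖v y‖ δ : ℝ) : ℂ) := by
      rw [hy]
      simp only [g, ContinuousMap.coe_mk]
      rw [← mul_div_assoc, Complex.mul_conj, Complex.normSq_eq_norm_sq]
      push_cast
      rfl
    change ‖V y‖ - δ ≤ (V y * g y).re
    rw [h2, Complex.ofReal_re, hy, le_div_iff₀ (hmax y)]
    rcases le_total ‖v y‖ δ with h | h
    · rw [max_eq_right h]
      nlinarith [norm_nonneg (v y)]
    · rw [max_eq_left h]
      nlinarith [norm_nonneg (v y)]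
  have h3 : (L1pairing μ V g).re - (L1pairing μ u g).re ≤ ε / 3 := by
    rw [← Complex.sub_re, ← LinearMap.sub_apply, ← map_sub]
    refine (Complex.re_le_norm _).trans ((norm_L1pairing_le _ _).trans ?_)
    rw [norm_sub_rev]
    calc ‖u - V‖ * ‖g‖ ≤ ‖u - V‖ * 1 := mul_le_mul_of_nonneg_left hg (norm_nonneg _)
      _ ≤ ε / 3 := by linarith
  have h4 : ‖u‖ ≤ ‖V‖ + ‖u - V‖ := by
    simpa using norm_add_le V (u - V)
  exact ⟨g, hg, by linarith⟩

end Pairing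

section Tensor

variable {X Y : Type*} [TopologicalSpace X] [TopologicalSpace Y]

open scoped TensorProduct

/-- The canonical algebra homomorphism `C(X) ⊗ C(Y) → C(X × Y)`. -/
def tensorToProd : C(X, ℂ) ⊗[ℂ] C(Y, ℂ) →ₐ[ℂ] C(X × Y, ℂ) :=
  Algebra.TensorProduct.productMap (ContinuousMap.compRightAlgHom ℂ ℂ ⟨Prod.fst, continuous_fst⟩)
    (ContinuousMap.compRightAlgHom ℂ ℂ ⟨Prod.snd, continuous_snd⟩)

theorem tensorToProd_tmul (f : C(X, ℂ)) (g : C(Y, ℂ)) :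
    tensorToProd (f ⊗ₜ[ℂ] g) = tensorCM f g := by
  ext p
  simp [tensorToProd, tensorCM]

variable [CompactSpace X] [CompactSpace Y]

theorem exists_continuousMap_apply_ne [T2Space X] {a b : X} (hab : a ≠ b) :
    ∃ f : C(X, ℂ), f a ≠ f b := by
  obtain ⟨f, h0, h1, -⟩ := exists_continuous_zero_one_of_isClosed (isClosed_singleton (x := a))
    (isClosed_singleton (x := b)) (by simpa using hab)
  have ha : f a = 0 := h0 (Set.mem_singleton a)
  have hb : f b = 1 := h1 (Set.mem_singleton b)
  exact ⟨⟨fun z => (f z : ℂ), by fun_prop⟩, by simp [ha, hb]⟩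

theorem denseRange_tensorToProd [T2Space X] [T2Space Y] :
    DenseRange (tensorToProd : C(X, ℂ) ⊗[ℂ] C(Y, ℂ) →ₐ[ℂ] C(X × Y, ℂ)) := by
  let A : StarSubalgebra ℂ C(X × Y, ℂ) :=
    { (tensorToProd : C(X, ℂ) ⊗[ℂ] C(Y, ℂ) →ₐ[ℂ] C(X × Y, ℂ)).range with
      star_mem' := by
        rintro _ ⟨x, rfl⟩
        change ∃ y, tensorToProd y = star (tensorToProd x)
        induction x with
        | zero => exact ⟨0, by simp⟩
        | tmul f g =>
          refine ⟨star f ⊗ₜ star g, ?_⟩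
          simp only [tensorToProd_tmul]
          ext p
          simp [tensorCM]
        | add x y hx hy =>
          obtain ⟨a, ha⟩ := hx
          obtain ⟨b, hb⟩ := hy
          exact ⟨a + b, by simp [ha, hb]⟩ }
  have hA : A.topologicalClosure = ⊤ := by
    refine ContinuousMap.starSubalgebra_topologicalClosure_eq_top_of_separatesPoints A ?_
    rintro ⟨a, b⟩ ⟨c, d⟩ hne
    by_cases hac : a = c
    · have hbd : b ≠ d := fun h => hne (by rw [hac, h])
      obtain ⟨g, hg⟩ := exists_continuousMap_apply_ne hbd
      exact ⟨_, ⟨_, ⟨1 ⊗ₜ g, rfl⟩, rfl⟩, by simpa [tensorToProd_tmul, tensorCM] using hg⟩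
    · obtain ⟨f, hf⟩ := exists_continuousMap_apply_ne hac
      exact ⟨_, ⟨_, ⟨f ⊗ₜ 1, rfl⟩, rfl⟩, by simpa [tensorToProd_tmul, tensorCM] using hf⟩
  intro F
  have : F ∈ A.topologicalClosure := hA ▸ StarSubalgebra.mem_top
  exact this

theorem clm_ext_tensorCM [T2Space X] [T2Space Y] {Λ Λ' : C(X × Y, ℂ) →L[ℂ] ℂ}
    (h : ∀ f g, Λ (tensorCM f g) = Λ' (tensorCM f g)) : Λ = Λ' := by
  refine DFunLike.coe_injective
    (denseRange_tensorToProd.equalizer Λ.continuous Λ'.continuous (funext fun x => ?_))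
  simp only [Function.comp_apply]
  induction x with
  | zero => simp
  | tmul f g => simpa [tensorToProd_tmul] using h f g
  | add x y hx hy => simp only [map_add, hx, hy]

variable [MeasurableSpace Y] [BorelSpace Y] {μ : Measure Y}

theorem PartitionBound.exists_functional [T2Space X] [T2Space Y] {T : C(X, ℂ) →ₗ[ℂ] Lp ℂ 1 μ}
    {C : ℝ} (hT : PartitionBound T C) :
    ∃ Λ : C(X × Y, ℂ) →L[ℂ] ℂ, ∀ f g, Λ (tensorCM f g) = ∫ y, T f y * g y ∂μ := by
  let B : C(X, ℂ) ⊗[ℂ] C(Y, ℂ) →ₗ[ℂ] ℂ := TensorProduct.lift ((L1pairing μ).comp T)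
  have hB : ∀ f g, B (f ⊗ₜ g) = L1pairing μ (T f) g := fun f g => rfl
  have hbound : ∀ x, ‖B x‖ ≤ C * ‖tensorToProd.toLinearMap x‖ := by
    intro x
    obtain ⟨S, hS⟩ := TensorProduct.exists_finset x
    refine le_of_forall_pos_le_add fun ε hε => ?_
    set G : ℝ := C * ∑ i ∈ S, ‖i.2‖ with hG
    have hG0 : 0 ≤ G := mul_nonneg hT.nonneg (Finset.sum_nonneg fun _ _ => norm_nonneg _)
    obtain ⟨n, χ, t, h0, h1, h2⟩ := exists_partition_approx (fun i : S => i.1.1)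
      (show 0 < ε / (G + 1) by positivity)
    have h2' : ∀ i ∈ S, ‖i.1 - ∑ j, i.1 (t j) • χ j‖ ≤ ε / (G + 1) := fun i hi => h2 ⟨i, hi⟩
    have hdec : B x = ∑ j, L1pairing μ (T (χ j)) (∑ i ∈ S, i.1 (t j) • i.2)
        + ∑ i ∈ S, L1pairing μ (T (i.1 - ∑ j, i.1 (t j) • χ j)) i.2 := by
      rw [hS, map_sum]
      simp only [hB, map_sub, map_sum, map_smul, LinearMap.sub_apply, LinearMap.sum_apply,
        LinearMap.smul_apply, Finset.sum_sub_distrib]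
      rw [Finset.sum_comm]
      abel
    have hfst : ∀ j, ‖∑ i ∈ S, i.1 (t j) • i.2‖ ≤ ‖tensorToProd x‖ := by
      intro j
      refine (ContinuousMap.norm_le _ (norm_nonneg _)).2 fun y => ?_
      have : (∑ i ∈ S, i.1 (t j) • i.2) y = tensorToProd x (t j, y) := by
        rw [hS]
        simp [tensorToProd_tmul, tensorCM, ContinuousMap.sum_apply]
      rw [this]
      exact ContinuousMap.norm_coe_le_norm _ _
    rw [hdec]
    refine (norm_add_le _ _).trans (add_le_add ?_ ?_)
    · calc _ ≤ ∑ j, ‖T (χ j)‖ * ‖tensorToProd x‖ :=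
            norm_sum_le_of_le _ fun j _ => (norm_L1pairing_le _ _).trans
              (mul_le_mul_of_nonneg_left (hfst j) (norm_nonneg _))
        _ ≤ _ := by
            rw [← Finset.sum_mul]
            exact mul_le_mul_of_nonneg_right (hT.2 n χ h0 h1) (norm_nonneg _)
    · calc _ ≤ ∑ i ∈ S, C * (ε / (G + 1)) * ‖i.2‖ :=
            norm_sum_le_of_le _ fun i hi => (norm_L1pairing_le _ _).trans
              (mul_le_mul_of_nonneg_right ((hT.1 _).trans
                (mul_le_mul_of_nonneg_left (h2' i hi) hT.nonneg)) (norm_nonneg _))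
        _ = G * (ε / (G + 1)) := by rw [← Finset.mul_sum, hG]; ring
        _ ≤ (G + 1) * (ε / (G + 1)) :=
            mul_le_mul_of_nonneg_right (by linarith) (by positivity)
        _ = ε := by field_simp
  have hdense : DenseRange
      (tensorToProd : C(X, ℂ) ⊗[ℂ] C(Y, ℂ) →ₐ[ℂ] C(X × Y, ℂ)).toLinearMap :=
    denseRange_tensorToProd
  refine ⟨B.extendOfNorm tensorToProd.toLinearMap, fun f g => ?_⟩
  have h := LinearMap.extendOfNorm_eq (f := B) hdense ⟨C, hbound⟩ (f ⊗ₜ g)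
  rw [AlgHom.toLinearMap_apply, tensorToProd_tmul, hB] at h
  exact h

theorem partitionBound_of_functional [T2Space X] [T2Space Y] [IsFiniteMeasure μ]
    [μ.WeaklyRegular] {T : C(X, ℂ) →ₗ[ℂ] Lp ℂ 1 μ} (Λ : C(X × Y, ℂ) →L[ℂ] ℂ)
    (hΛ : ∀ f g, Λ (tensorCM f g) = ∫ y, T f y * g y ∂μ) : PartitionBound T ‖Λ‖ := by
  refine ⟨fun f => le_of_forall_pos_le_add fun ε hε => ?_, fun n χ h0 h1 =>
    le_of_forall_pos_le_add fun ε hε => ?_⟩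
  · obtain ⟨g, hg, hgε⟩ := exists_norming_continuousMap (T f) hε
    rw [L1pairing_apply, ← hΛ] at hgε
    have h2 : ‖tensorCM f g‖ ≤ ‖f‖ := by
      refine (ContinuousMap.norm_le _ (norm_nonneg _)).2 fun p => ?_
      change ‖f p.1 * g p.2‖ ≤ _
      rw [norm_mul]
      exact (mul_le_of_le_one_right (norm_nonneg _) ((g.norm_coe_le_norm _).trans hg)).trans
        (f.norm_coe_le_norm _)
    have h3 := (Complex.re_le_norm _).trans (Λ.le_opNorm_of_le h2)
    linarith
  · have hε' : 0 < ε / (n + 1) := by positivity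
    choose g hg hgε using fun j => exists_norming_continuousMap (T (χ j)) hε'
    simp only [L1pairing_apply, ← hΛ] at hgε
    have h2 : ‖∑ j, tensorCM (χ j) (g j)‖ ≤ 1 := by
      refine (ContinuousMap.norm_le _ zero_le_one).2 fun p => ?_
      rw [ContinuousMap.sum_apply]
      have hs : ∑ j, ‖χ j p.1‖ = 1 := by
        have := congrArg (fun F : C(X, ℂ) => F p.1) h1
        simp only [ContinuousMap.sum_apply, ContinuousMap.one_apply] at this
        have h' : ((∑ j, ‖χ j p.1‖ : ℝ) : ℂ) = 1 := by
          rw [← this]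
          push_cast
          exact Finset.sum_congr rfl fun j _ => Complex.norm_of_nonneg' (h0 j p.1)
        exact_mod_cast h'
      rw [← hs]
      refine norm_sum_le_of_le _ fun j _ => ?_
      change ‖χ j p.1 * g j p.2‖ ≤ _
      rw [norm_mul]
      exact mul_le_of_le_one_right (norm_nonneg _) (((g j).norm_coe_le_norm _).trans (hg j))
    have h3 := (Complex.re_le_norm _).trans (Λ.le_opNorm_of_le h2)
    rw [map_sum, Complex.re_sum, mul_one] at h3
    have h4 : ∑ j, ‖T (χ j)‖ ≤ ∑ j, ((Λ (tensorCM (χ j) (g j))).re + ε / (n + 1)) :=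
      Finset.sum_le_sum fun j _ => by linarith [hgε j]
    rw [Finset.sum_add_distrib, Finset.sum_const, Finset.card_univ, Fintype.card_fin,
      nsmul_eq_mul] at h4
    have h5 : (n : ℝ) * (ε / (n + 1)) ≤ ε := by
      rw [mul_div_assoc', div_le_iff₀ (by positivity)]
      nlinarith
    linarith

end Tensor

section ReIm

variable {X : Type*} [TopologicalSpace X]

/-- The inclusion `C(X;ℝ) → C(X;ℂ)`. -/
def ofRealCM : C(X, ℝ) →ₗ[ℝ] C(X, ℂ) where
  toFun f := ⟨fun x => (f x : ℂ), by fun_prop⟩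
  map_add' f g := by ext x; simp
  map_smul' c f := by ext x; simp

/-- The real part `C(X;ℂ) → C(X;ℝ)`. -/
def reCM : C(X, ℂ) →ₗ[ℝ] C(X, ℝ) where
  toFun f := ⟨fun x => (f x).re, by fun_prop⟩
  map_add' f g := by ext x; simp
  map_smul' c f := by ext x; simp

/-- The imaginary part `C(X;ℂ) → C(X;ℝ)`. -/
def imCM : C(X, ℂ) →ₗ[ℝ] C(X, ℝ) where
  toFun f := ⟨fun x => (f x).im, by fun_prop⟩
  map_add' f g := by ext x; simp
  map_smul' c f := by ext x; simp

@[simp] theorem ofRealCM_apply (f : C(X, ℝ)) (x : X) : ofRealCM f x = (f x : ℂ) := rfl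

@[simp] theorem reCM_apply (f : C(X, ℂ)) (x : X) : reCM f x = (f x).re := rfl

@[simp] theorem imCM_apply (f : C(X, ℂ)) (x : X) : imCM f x = (f x).im := rfl

theorem ofRealCM_re_add_im (f : C(X, ℂ)) :
    ofRealCM (reCM f) + Complex.I • ofRealCM (imCM f) = f := by
  ext x
  simp [mul_comm Complex.I, Complex.re_add_im]

theorem reCM_smul (c : ℂ) (f : C(X, ℂ)) :
    reCM (c • f) = c.re • reCM f - c.im • imCM f := by
  ext x
  simp

theorem imCM_smul (c : ℂ) (f : C(X, ℂ)) :
    imCM (c • f) = c.re • imCM f + c.im • reCM f := by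
  ext x
  simp

variable {α : Type*} [MeasurableSpace α] {μ : Measure α}

/-- The inclusion `L¹(μ;ℝ) → L¹(μ;ℂ)`. -/
def L1ofReal (μ : Measure α) : Lp ℝ 1 μ →L[ℝ] Lp ℂ 1 μ := Complex.ofRealCLM.compLpL 1 μ

theorem L1ofReal_coeFn (u : Lp ℝ 1 μ) : ∀ᵐ x ∂μ, L1ofReal μ u x = (u x : ℂ) :=
  Complex.ofRealCLM.coeFn_compLpL u

/-- The complex linear extension of a real linear operator. -/
def complexify (S : C(X, ℝ) →ₗ[ℝ] Lp ℝ 1 μ) : C(X, ℂ) →ₗ[ℂ] Lp ℂ 1 μ where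
  toFun f := L1ofReal μ (S (reCM f)) + Complex.I • L1ofReal μ (S (imCM f))
  map_add' f g := by
    simp only [map_add, smul_add]
    abel
  map_smul' c f := by
    simp only [reCM_smul, imCM_smul, map_add, map_sub, map_smul, RingHom.id_apply]
    generalize L1ofReal μ (S (reCM f)) = a
    generalize L1ofReal μ (S (imCM f)) = b
    have hr : ∀ (r : ℝ) (u : Lp ℂ 1 μ), r • u = (r : ℂ) • u :=
      fun r u => (algebraMap_smul ℂ r u).symm
    rw [hr, hr, hr, hr]
    have hc : c = c.re + c.im * Complex.I := (Complex.re_add_im c).symm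
    match_scalars
    · linear_combination -hc
    · linear_combination -Complex.I * hc - c.im * Complex.I_mul_I

theorem complexify_apply (S : C(X, ℝ) →ₗ[ℝ] Lp ℝ 1 μ) (f : C(X, ℂ)) :
    complexify S f = L1ofReal μ (S (reCM f)) + Complex.I • L1ofReal μ (S (imCM f)) := rfl

end ReIm

section Representation

variable {X : Type*} [TopologicalSpace X] [CompactSpace X] [T2Space X] [MeasurableSpace X]
  [BorelSpace X]

/-- Riesz–Markov–Kakutani on a compact space. -/
theorem exists_measure_of_positive (φ : C(X, ℝ) →ₗ[ℝ] ℝ) (hφ : ∀ f, 0 ≤ f → 0 ≤ φ f) :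
    ∃ ν : Measure X, ν.Regular ∧ IsFiniteMeasure ν ∧ ∀ f : C(X, ℝ), φ f = ∫ x, f x ∂ν := by
  let ψ : CompactlySupportedContinuousMap X ℝ →ₗ[ℝ] ℝ :=
    { toFun := fun f => φ f.toContinuousMap
      map_add' := fun f g => map_add φ f.toContinuousMap g.toContinuousMap
      map_smul' := fun c f => map_smul φ c f.toContinuousMap }
  let Λ : CompactlySupportedContinuousMap X ℝ →ₚ[ℝ] ℝ :=
    PositiveLinearMap.mk₀ ψ fun f hf => hφ _ hf
  refine ⟨RealRMK.rieszMeasure Λ, inferInstance, inferInstance, fun f => ?_⟩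
  exact (RealRMK.integral_rieszMeasure Λ
    (CompactlySupportedContinuousMap.continuousMapEquiv f)).symm

end Representation

section Operators

variable {α : Type*} [MeasurableSpace α] {μ : Measure α}

/-- The real part `L¹(μ;ℂ) → L¹(μ;ℝ)`. -/
def L1re (μ : Measure α) : Lp ℂ 1 μ →L[ℝ] Lp ℝ 1 μ := Complex.reCLM.compLpL 1 μ

/-- The imaginary part `L¹(μ;ℂ) → L¹(μ;ℝ)`. -/
def L1im (μ : Measure α) : Lp ℂ 1 μ →L[ℝ] Lp ℝ 1 μ := Complex.imCLM.compLpL 1 μ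

theorem L1re_coeFn (u : Lp ℂ 1 μ) : ∀ᵐ x ∂μ, L1re μ u x = (u x).re :=
  Complex.reCLM.coeFn_compLpL u

theorem L1im_coeFn (u : Lp ℂ 1 μ) : ∀ᵐ x ∂μ, L1im μ u x = (u x).im :=
  Complex.imCLM.coeFn_compLpL u

theorem L1re_le_L1abs (u : Lp ℂ 1 μ) : L1re μ u ≤ L1abs u := by
  rw [← Lp.coeFn_le]
  filter_upwards [L1re_coeFn u, L1abs_coeFn u] with x h1 h2
  rw [h1, h2]
  exact Complex.re_le_norm _

theorem L1im_le_L1abs (u : Lp ℂ 1 μ) : L1im μ u ≤ L1abs u := by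
  rw [← Lp.coeFn_le]
  filter_upwards [L1im_coeFn u, L1abs_coeFn u] with x h1 h2
  rw [h1, h2]
  exact (le_abs_self _).trans (Complex.abs_im_le_norm _)

theorem L1ofReal_re_add_im (u : Lp ℂ 1 μ) :
    L1ofReal μ (L1re μ u) + Complex.I • L1ofReal μ (L1im μ u) = u := by
  refine Lp.ext ?_
  filter_upwards [Lp.coeFn_add (L1ofReal μ (L1re μ u)) (Complex.I • L1ofReal μ (L1im μ u)),
    Lp.coeFn_smul Complex.I (L1ofReal μ (L1im μ u)), L1ofReal_coeFn (L1re μ u),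
    L1ofReal_coeFn (L1im μ u), L1re_coeFn u, L1im_coeFn u] with x h1 h2 h3 h4 h5 h6
  rw [h1, Pi.add_apply, h2, Pi.smul_apply, h3, h4, h5, h6, smul_eq_mul, mul_comm,
    Complex.re_add_im]

variable {X : Type*} [TopologicalSpace X]

theorem ofReal_le_iff_le_norm {z : ℂ} (hz : 0 ≤ z) (r : ℝ) : (r : ℂ) ≤ z ↔ r ≤ ‖z‖ := by
  rw [← Complex.norm_of_nonneg' hz, Complex.real_le_real, Complex.norm_real, norm_norm]

theorem orderBounded_iff_L1abs_le {T : C(X, ℂ) → Lp ℂ 1 μ} :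
    OrderBounded T ↔ ∀ f : C(X, ℂ), (∀ t, 0 ≤ f t) →
      ∃ w : Lp ℝ 1 μ, ∀ g : C(X, ℂ), (∀ t, ‖g t‖ ≤ ‖f t‖) → L1abs (T g) ≤ w := by
  refine ⟨fun h f hf => ?_, fun h f hf => ?_⟩
  · obtain ⟨k, -, hk⟩ := h f hf
    refine ⟨L1re μ k, fun g hg => ?_⟩
    rw [← Lp.coeFn_le]
    filter_upwards [L1abs_coeFn (T g), L1re_coeFn k,
      hk g fun t => (ofReal_le_iff_le_norm (hf t) _).2 (hg t)] with x h1 h2 h3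
    rw [h1, h2]
    exact (Complex.le_def.1 h3).1
  · obtain ⟨w, hw⟩ := h f hf
    refine ⟨L1ofReal μ w, ?_, fun g hg => ?_⟩
    · have h0 : 0 ≤ w := (L1abs_nonneg _).trans (hw 0 fun t => by simp)
      filter_upwards [L1ofReal_coeFn w, (Lp.coeFn_nonneg w).2 h0] with x h1 h2
      rw [h1]
      exact Complex.zero_le_real.2 h2
    · have h0 := hw g fun t => (ofReal_le_iff_le_norm (hf t) _).1 (hg t)
      filter_upwards [L1ofReal_coeFn w, L1abs_coeFn (T g), (Lp.coeFn_le _ _).2 h0] with x h1 h2 h3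
      rw [h1, ← h2]
      exact Complex.real_le_real.2 h3

theorem PositiveOp.L1re_nonneg {P : C(X, ℂ) → Lp ℂ 1 μ} (hP : PositiveOp P) {f : C(X, ℂ)}
    (hf : ∀ t, 0 ≤ f t) : 0 ≤ L1re μ (P f) := by
  rw [← Lp.coeFn_nonneg]
  filter_upwards [L1re_coeFn (P f), hP f hf] with x h1 h2
  rw [h1]
  exact (Complex.le_def.1 h2).1

theorem PositiveOp.L1abs_ofReal_le {P : C(X, ℂ) →ₗ[ℂ] Lp ℂ 1 μ} (hP : PositiveOp P)
    {f u : C(X, ℝ)} (hu : ∀ t, |u t| ≤ f t) :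
    L1abs (P (ofRealCM u)) ≤ L1re μ (P (ofRealCM f)) := by
  have h1 := hP (ofRealCM f - ofRealCM u) fun t => by
    simpa [← Complex.ofReal_sub] using (le_abs_self _).trans (hu t)
  have h2 := hP (ofRealCM f + ofRealCM u) fun t => by
    rw [ContinuousMap.add_apply, ofRealCM_apply, ofRealCM_apply, ← Complex.ofReal_add,
      Complex.zero_le_real]
    linarith [neg_abs_le (u t), hu t]
  rw [map_sub] at h1
  rw [map_add] at h2
  rw [← Lp.coeFn_le]
  filter_upwards [L1abs_coeFn (P (ofRealCM u)), L1re_coeFn (P (ofRealCM f)), h1, h2,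
    Lp.coeFn_sub (P (ofRealCM f)) (P (ofRealCM u)),
    Lp.coeFn_add (P (ofRealCM f)) (P (ofRealCM u))] with x e1 e2 h1 h2 e3 e4
  rw [e3, Pi.sub_apply, Complex.le_def] at h1
  rw [e4, Pi.add_apply, Complex.le_def] at h2
  simp only [Complex.zero_re, Complex.zero_im, Complex.sub_re, Complex.sub_im, Complex.add_re,
    Complex.add_im] at h1 h2
  rw [e1, e2, Complex.abs_re_eq_norm.2 (by linarith [h1.2, h2.2]) |>.symm, abs_le]
  constructor <;> linarith [h1.1, h2.1]

theorem PositiveOp.L1abs_le {P : C(X, ℂ) →ₗ[ℂ] Lp ℂ 1 μ} (hP : PositiveOp P)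
    {f : C(X, ℝ)} {g : C(X, ℂ)} (hg : ∀ t, ‖g t‖ ≤ f t) :
    L1abs (P g) ≤ (2 : ℝ) • L1re μ (P (ofRealCM f)) := by
  conv_lhs => rw [← ofRealCM_re_add_im g, map_add, map_smul]
  refine (L1abs_add_le _ _).trans ?_
  rw [L1abs_smul, Complex.norm_I, one_smul, two_smul]
  exact add_le_add
    (hP.L1abs_ofReal_le fun t => (Complex.abs_re_le_norm _).trans (hg t))
    (hP.L1abs_ofReal_le fun t => (Complex.abs_im_le_norm _).trans (hg t))

/-- A regular operator is dominated by a positive one. -/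
theorem RegularOp.exists_dominating {T : C(X, ℂ) →ₗ[ℂ] Lp ℂ 1 μ} (hT : RegularOp T) :
    ∃ Φ : C(X, ℝ) →ₗ[ℝ] Lp ℝ 1 μ, (∀ f, 0 ≤ f → 0 ≤ Φ f) ∧
      ∀ (f : C(X, ℝ)) (g : C(X, ℂ)), (∀ t, ‖g t‖ ≤ f t) → L1abs (T g) ≤ Φ f := by
  obtain ⟨n, c, P, hP, rfl⟩ := hT
  let R : Fin n → (C(X, ℝ) →ₗ[ℝ] Lp ℝ 1 μ) := fun i =>
    (L1re μ).toLinearMap ∘ₗ (P i).restrictScalars ℝ ∘ₗ ofRealCM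
  have hR : ∀ i f, R i f = L1re μ (P i (ofRealCM f)) := fun i f => rfl
  refine ⟨∑ i, ‖c i‖ • (2 : ℝ) • R i, fun f hf => ?_, fun f g hg => ?_⟩
  · simp only [LinearMap.sum_apply, LinearMap.smul_apply, hR]
    refine Finset.sum_nonneg fun i _ => smul_nonneg (norm_nonneg _) (smul_nonneg zero_le_two ?_)
    exact (hP i).L1re_nonneg fun t => Complex.zero_le_real.2 (hf t)
  · simp only [LinearMap.sum_apply, LinearMap.smul_apply, hR]
    refine (L1abs_sum_le _ _).trans (Finset.sum_le_sum fun i _ => ?_)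
    rw [L1abs_smul]
    exact smul_le_smul_of_nonneg_left ((hP i).L1abs_le hg) (norm_nonneg _)

theorem RegularOp.orderBounded {T : C(X, ℂ) →ₗ[ℂ] Lp ℂ 1 μ} (hT : RegularOp T) :
    OrderBounded T := by
  obtain ⟨Φ, -, hΦ⟩ := hT.exists_dominating
  refine orderBounded_iff_L1abs_le.2 fun f hf => ⟨Φ (reCM f), fun g hg => hΦ _ _ fun t => ?_⟩
  obtain ⟨hre, him⟩ := Complex.le_def.1 (hf t)
  exact (hg t).trans_eq (by
    rw [reCM_apply, ← Complex.abs_re_eq_norm.2 him.symm, abs_of_nonneg hre])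

theorem RegularOp.exists_measure [CompactSpace X] [T2Space X] [MeasurableSpace X] [BorelSpace X]
    {T : C(X, ℂ) →ₗ[ℂ] Lp ℂ 1 μ} (hT : RegularOp T) :
    ∃ ν : Measure X, ν.Regular ∧ IsFiniteMeasure ν ∧ ∀ f : C(X, ℂ), ‖T f‖ ≤ ∫ t, ‖f t‖ ∂ν := by
  obtain ⟨Φ, hΦ0, hΦ⟩ := hT.exists_dominating
  let φ : C(X, ℝ) →ₗ[ℝ] ℝ :=
    { toFun := fun f => ∫ x, Φ f x ∂μ
      map_add' := fun f g => by rw [map_add, L1_integral_add]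
      map_smul' := fun c f => by rw [map_smul, L1_integral_smul]; rfl }
  obtain ⟨ν, h1, h2, hν⟩ := exists_measure_of_positive φ fun f hf => by
    change 0 ≤ ∫ x, Φ f x ∂μ
    rw [← L1_norm_eq_integral_of_nonneg (hΦ0 f hf)]
    exact norm_nonneg _
  refine ⟨ν, h1, h2, fun f => ?_⟩
  rw [← integral_L1abs]
  exact (L1_integral_mono (hΦ ⟨fun t => ‖f t‖, by fun_prop⟩ f fun t => le_rfl)).trans_eq (hν _)

theorem positiveOp_complexify {P : C(X, ℝ) →ₗ[ℝ] Lp ℝ 1 μ} (hP : ∀ f, 0 ≤ f → 0 ≤ P f) :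
    PositiveOp (complexify P) := by
  intro f hf
  have h0 : imCM f = 0 := by
    ext t
    exact (Complex.le_def.1 (hf t)).2.symm
  rw [complexify_apply, h0, map_zero, map_zero, smul_zero, add_zero]
  filter_upwards [L1ofReal_coeFn (P (reCM f)),
    (Lp.coeFn_nonneg _).2 (hP (reCM f) fun t => (Complex.le_def.1 (hf t)).1)] with x h1 h2
  rw [h1]
  exact Complex.zero_le_real.2 h2

/-- A real component of an order-bounded operator is a difference of positive operators. -/
theorem OrderBounded.exists_sub {T : C(X, ℂ) →ₗ[ℂ] Lp ℂ 1 μ} (hT : OrderBounded T)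
    (A : Lp ℂ 1 μ →L[ℝ] Lp ℝ 1 μ) (hA : ∀ u, A u ≤ L1abs u) :
    ∃ P Q : C(X, ℝ) →ₗ[ℝ] Lp ℝ 1 μ, (∀ f, 0 ≤ f → 0 ≤ P f) ∧ (∀ f, 0 ≤ f → 0 ≤ Q f) ∧
      ∀ f, A (T (ofRealCM f)) = P f - Q f := by
  let S : C(X, ℝ) →ₗ[ℝ] Lp ℝ 1 μ := A.toLinearMap ∘ₗ T.restrictScalars ℝ ∘ₗ ofRealCM
  have hS : ∀ f, S f = A (T (ofRealCM f)) := fun f => rfl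
  obtain ⟨P, hP⟩ := exists_positive_linearMap_ge S fun f hf => by
    obtain ⟨w, hw⟩ := orderBounded_iff_L1abs_le.1 hT (ofRealCM f)
      fun t => Complex.zero_le_real.2 (hf t)
    have hub : ∀ u ∈ S '' Set.Icc 0 f, u ≤ w := by
      rintro _ ⟨g, hg, rfl⟩
      refine (hA _).trans (hw _ fun t => ?_)
      have h0 : 0 ≤ g t := hg.1 t
      have h1 : g t ≤ f t := hg.2 t
      simpa [abs_of_nonneg h0, abs_of_nonneg (h0.trans h1)] using h1
    obtain ⟨v, hv, -⟩ := L1_exists_isLUB (s := S '' Set.Icc 0 f) (M := ∫ x, w x ∂μ)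
      ((Set.nonempty_Icc.2 hf).image _) fun t ht => ⟨w, fun u hu => hub u (ht hu), le_rfl⟩
    exact ⟨v, hv⟩
  exact ⟨P, P - S, fun f hf => (hP f hf).1, fun f hf => sub_nonneg.2 (hP f hf).2,
    fun f => by simp [hS]⟩

theorem OrderBounded.regularOp {T : C(X, ℂ) →ₗ[ℂ] Lp ℂ 1 μ} (hT : OrderBounded T) :
    RegularOp T := by
  obtain ⟨P, Q, hP, hQ, h1⟩ := hT.exists_sub (L1re μ) L1re_le_L1abs
  obtain ⟨P', Q', hP', hQ', h2⟩ := hT.exists_sub (L1im μ) L1im_le_L1abs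
  refine ⟨4, ![1, -1, Complex.I, -Complex.I],
    ![complexify P, complexify Q, complexify P', complexify Q'], ?_, ?_⟩
  · simp only [Fin.forall_fin_succ, Matrix.cons_val_zero, Matrix.cons_val_succ]
    exact ⟨positiveOp_complexify hP, positiveOp_complexify hQ, positiveOp_complexify hP',
      positiveOp_complexify hQ', fun i => i.elim0⟩
  · refine LinearMap.ext fun f => ?_
    have h3 : ∀ u : C(X, ℝ), T (ofRealCM u) =
        L1ofReal μ (P u) - L1ofReal μ (Q u) +
          Complex.I • (L1ofReal μ (P' u) - L1ofReal μ (Q' u)) := fun u => by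
      rw [← map_sub, ← map_sub, ← h1, ← h2, L1ofReal_re_add_im]
    conv_lhs => rw [← ofRealCM_re_add_im f, map_add, map_smul, h3, h3]
    simp only [Fin.sum_univ_four, Matrix.cons_val, LinearMap.add_apply, LinearMap.smul_apply,
      complexify_apply]
    module

end Operators

section Domination

variable {X : Type*} [TopologicalSpace X] [CompactSpace X]
  {α : Type*} [MeasurableSpace α] {μ : Measure α} {T : C(X, ℂ) →ₗ[ℂ] Lp ℂ 1 μ}

theorem PartitionBound.orderBounded [T2Space X] {C : ℝ} (hT : PartitionBound T C) :
    OrderBounded T := by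
  refine orderBounded_iff_L1abs_le.2 fun f _ => ?_
  obtain ⟨w, hw, -⟩ := exists_isLUB_L1abs hT.nonneg hT.1 f (M := ‖f‖ * C) one_pos
    fun n χ t h0 h1 _ => by
      refine le_trans ?_ (mul_le_mul_of_nonneg_left (hT.2 n χ h0 h1) (norm_nonneg f))
      rw [Finset.mul_sum]
      exact Finset.sum_le_sum fun j _ =>
        mul_le_mul_of_nonneg_right (f.norm_coe_le_norm _) (norm_nonneg _)
  exact ⟨w, fun g hg => hw.1 ⟨g, hg, rfl⟩⟩

variable [MeasurableSpace X] [BorelSpace X] {ν : Measure X} [IsFiniteMeasure ν]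

theorem integrable_norm_continuousMap (f : C(X, ℂ)) : Integrable (fun t => ‖f t‖) ν :=
  (show Continuous fun t => ‖f t‖ by fun_prop).integrable_of_hasCompactSupport
    (HasCompactSupport.of_compactSpace _)

theorem integral_norm_le_norm_mul (f : C(X, ℂ)) : ∫ t, ‖f t‖ ∂ν ≤ ν.real Set.univ * ‖f‖ := by
  rw [← smul_eq_mul, ← integral_const]
  exact integral_mono (integrable_norm_continuousMap f) (integrable_const _) f.norm_coe_le_norm

theorem sum_mul_integral_norm {n : ℕ} (a : Fin n → ℂ) (ha : ∀ j, 0 ≤ a j)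
    {χ : Fin n → C(X, ℂ)} (hχ : ∀ j x, 0 ≤ χ j x) :
    ∑ j, ‖a j‖ * ∫ t, ‖χ j t‖ ∂ν = ∫ t, ‖(∑ j, a j • χ j) t‖ ∂ν := by
  simp only [← integral_const_mul]
  rw [← integral_finsetSum _ fun j _ => (integrable_norm_continuousMap (χ j)).const_mul _]
  refine integral_congr_ae (Filter.Eventually.of_forall fun t => ?_)
  apply Complex.ofReal_injective
  simp only [ContinuousMap.sum_apply, ContinuousMap.smul_apply, smul_eq_mul]
  rw [Complex.norm_of_nonneg' (Finset.sum_nonneg fun j _ => mul_nonneg (ha j) (hχ j t))]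
  push_cast
  exact Finset.sum_congr rfl fun j _ => by
    rw [Complex.norm_of_nonneg' (ha j), Complex.norm_of_nonneg' (hχ j t)]

theorem partitionBound_of_measure (hT : ∀ f : C(X, ℂ), ‖T f‖ ≤ ∫ t, ‖f t‖ ∂ν) :
    PartitionBound T (ν.real Set.univ) := by
  refine ⟨fun f => (hT f).trans (integral_norm_le_norm_mul f), fun n χ h0 h1 => ?_⟩
  refine (Finset.sum_le_sum fun j _ => hT (χ j)).trans ?_
  have h := sum_mul_integral_norm (ν := ν) (fun _ => 1) (fun _ => zero_le_one) h0
  simp only [norm_one, one_mul, one_smul, h1] at h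
  rw [h]
  simp

/-- The supremum of `{|Tg| : |g| ≤ f}` has integral at most `∫ f dν` whenever `ν` dominates `T`. -/
theorem exists_isLUB_L1abs_of_measure [T2Space X] (hT : ∀ f : C(X, ℂ), ‖T f‖ ≤ ∫ t, ‖f t‖ ∂ν)
    {f : C(X, ℂ)} (hf : ∀ t, 0 ≤ f t) :
    ∃ w : Lp ℝ 1 μ, IsLUB ((fun g => L1abs (T g)) '' {g | ∀ x, ‖g x‖ ≤ ‖f x‖}) w ∧
      ∫ x, w x ∂μ ≤ ∫ t, ‖f t‖ ∂ν := by
  set m : ℝ := ν.real Set.univ with hm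
  have hm0 : 0 ≤ m := measureReal_nonneg
  have hP := partitionBound_of_measure hT
  have key : ∀ δ : ℝ, 0 < δ → ∃ w : Lp ℝ 1 μ,
      IsLUB ((fun g => L1abs (T g)) '' {g | ∀ x, ‖g x‖ ≤ ‖f x‖}) w ∧
      ∫ x, w x ∂μ ≤ (∫ t, ‖f t‖ ∂ν + m * δ) + δ := by
    intro δ hδ
    refine exists_isLUB_L1abs hP.nonneg hP.1 f hδ fun n χ p h0 _ h2 => ?_
    calc _ ≤ ∑ j, ‖f (p j)‖ * ∫ t, ‖χ j t‖ ∂ν :=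
          Finset.sum_le_sum fun j _ => mul_le_mul_of_nonneg_left (hT _) (norm_nonneg _)
      _ = ∫ t, ‖(∑ j, f (p j) • χ j) t‖ ∂ν := sum_mul_integral_norm _ (fun j => hf _) h0
      _ ≤ ∫ t, (‖f t‖ + ‖(f - ∑ j, f (p j) • χ j) t‖) ∂ν := by
          refine integral_mono (integrable_norm_continuousMap _)
            ((integrable_norm_continuousMap _).add (integrable_norm_continuousMap _)) fun t => ?_
          have := norm_sub_le (f t) ((f - ∑ j, f (p j) • χ j) t)
          rwa [ContinuousMap.sub_apply, sub_sub_cancel] at this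
      _ = ∫ t, ‖f t‖ ∂ν + ∫ t, ‖(f - ∑ j, f (p j) • χ j) t‖ ∂ν :=
          integral_add (integrable_norm_continuousMap _) (integrable_norm_continuousMap _)
      _ ≤ _ := by
          gcongr
          exact (integral_norm_le_norm_mul _).trans (mul_le_mul_of_nonneg_left h2 hm0)
  obtain ⟨w, hw, -⟩ := key 1 one_pos
  refine ⟨w, hw, le_of_forall_pos_le_add fun ε hε => ?_⟩
  obtain ⟨w', hw', hle⟩ := key (ε / (m + 1)) (by positivity)
  rw [hw.unique hw']
  refine hle.trans_eq ?_
  field_simp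
  ring

theorem integral_linearModulus_le [T2Space X] (hT : ∀ f : C(X, ℂ), ‖T f‖ ≤ ∫ t, ‖f t‖ ∂ν)
    {absT : C(X, ℂ) → Lp ℂ 1 μ} (hmod : IsLinearModulus T absT)
    {f : C(X, ℂ)} (hf : ∀ t, 0 ≤ f t) : ∫ x, absT f x ∂μ ≤ ∫ t, f t ∂ν := by
  obtain ⟨w, hw, hle⟩ := exists_isLUB_L1abs_of_measure hT hf
  have h1 : ∀ᵐ x ∂μ, absT f x ≤ L1ofReal μ w x := by
    refine (hmod f hf).2 _ fun g hg => ?_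
    have h0 : L1abs (T g) ≤ w :=
      hw.1 ⟨g, fun t => (ofReal_le_iff_le_norm (hf t) _).1 (hg t), rfl⟩
    filter_upwards [L1ofReal_coeFn w, L1abs_coeFn (T g), (Lp.coeFn_le _ _).2 h0] with x h1 h2 h3
    rw [h1, ← h2]
    exact Complex.real_le_real.2 h3
  calc ∫ x, absT f x ∂μ ≤ ∫ x, L1ofReal μ w x ∂μ :=
        integral_mono_ae (L1.integrable_coeFn _) (L1.integrable_coeFn _) h1
    _ = ((∫ x, w x ∂μ : ℝ) : ℂ) := by
        rw [integral_congr_ae (L1ofReal_coeFn w)]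
        exact integral_ofReal
    _ ≤ ((∫ t, ‖f t‖ ∂ν : ℝ) : ℂ) := Complex.real_le_real.2 hle
    _ = ∫ t, f t ∂ν := by
        rw [← integral_complex_ofReal]
        exact integral_congr_ae (Filter.Eventually.of_forall fun t =>
          Complex.norm_of_nonneg' (hf t))

end Domination

/-- **Regular = integral** (Theorem `ot.t:reg=int` of the paper).  For a linear
operator `T : C(K;ℂ) → L¹(L,μ)` over a compact measure space `(L,μ)` the following are
equivalent: (i) order-bounded; (ii) regular; (iii) `T` is an `L¹(ν)`-`L¹(μ)`-contraction
for some finite positive regular Borel measure `ν` on `K`; (iv) the bilinear form of `T`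
is represented by a (unique) continuous linear functional on `C(K×L;ℂ)`.  Moreover every
`ν` as in (iii) dominates `|T|'μ`. -/
theorem orderBounded_iff_integral_representation
    (μ : Measure L) [IsFiniteMeasure μ] (hμ : μ.Regular)
    (T : C(K, ℂ) →ₗ[ℂ] Lp ℂ 1 μ) :
    (OrderBounded ⇑T ↔ RegularOp T) ∧
    (OrderBounded ⇑T ↔
      ∃ ν : Measure K, ν.Regular ∧ IsFiniteMeasure ν ∧
        ∀ f : C(K, ℂ), ‖T f‖ ≤ ∫ t, ‖f t‖ ∂ν) ∧
    (OrderBounded ⇑T ↔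
      ∃ Λ : C(K × L, ℂ) →L[ℂ] ℂ,
        ∀ (f : C(K, ℂ)) (g : C(L, ℂ)),
          Λ (tensorCM f g) = ∫ y, T f y * g y ∂μ) ∧
    (∀ Λ Λ' : C(K × L, ℂ) →L[ℂ] ℂ,
      (∀ (f : C(K, ℂ)) (g : C(L, ℂ)), Λ (tensorCM f g) = ∫ y, T f y * g y ∂μ) →
      (∀ (f : C(K, ℂ)) (g : C(L, ℂ)), Λ' (tensorCM f g) = ∫ y, T f y * g y ∂μ) →
      Λ = Λ') ∧
    (∀ ν : Measure K, ν.Regular → IsFiniteMeasure ν →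
      (∀ f : C(K, ℂ), ‖T f‖ ≤ ∫ t, ‖f t‖ ∂ν) →
      ∀ absT : C(K, ℂ) →ₗ[ℂ] Lp ℂ 1 μ, PositiveOp ⇑absT → IsLinearModulus ⇑T ⇑absT →
      ∀ f : C(K, ℂ), (∀ t, 0 ≤ f t) →
        ∫ x, absT f x ∂μ ≤ ∫ t, f t ∂ν) := by
  have hiii : (∃ ν : Measure K, ν.Regular ∧ IsFiniteMeasure ν ∧
      ∀ f : C(K, ℂ), ‖T f‖ ≤ ∫ t, ‖f t‖ ∂ν) → ∃ C, PartitionBound T C := by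
    rintro ⟨ν, -, _, hν⟩
    exact ⟨_, partitionBound_of_measure hν⟩
  refine ⟨⟨fun h => h.regularOp, fun h => h.orderBounded⟩,
    ⟨fun h => h.regularOp.exists_measure, fun h => ?_⟩, ⟨fun h => ?_, fun ⟨Λ, hΛ⟩ => ?_⟩,
    fun Λ Λ' h h' => clm_ext_tensorCM fun f g => by rw [h, h'],
    fun ν _ _ hν absT _ hmod f hf => integral_linearModulus_le hν hmod hf⟩
  · obtain ⟨C, hC⟩ := hiii h
    exact hC.orderBounded
  · obtain ⟨C, hC⟩ := hiii h.regularOp.exists_measure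
    exact hC.exists_functional
  · exact (partitionBound_of_functional Λ hΛ).orderBounded

end
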